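/- Let T : X → X be an operator. Then the following are equivalent: (1) T is F_ps-transitive, i.e. N(U,V) is piecewise syndetic for all nonempty open U,V ⊆ X; (2) T is weakly disjoint from every topologically ergodic operator; (3) T is weakly disjoint from every invertible topologically ergodic bilateral weighted backward shift on Y, where Y = c₀(ℤ) or ℓ^p(ℤ), 1 ≤ p < ∞. -/

import Mathlib

open Set Topology Function Filter
open scoped ENNReal

/- ### Basic dynamical notions -/

/-- The return time set `N(U,V) = {n ∈ ℕ : T^n(U) ∩ V ≠ ∅}`. -/
def nset {X : Type*} (T : X → X) (U V : Set X) : Set ℕ :=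
  {n : ℕ | ∃ x ∈ U, T^[n] x ∈ V}

/-- A Furstenberg family: nonempty, hereditary upward, not containing `∅`. -/
def IsFamily (F : Set (Set ℕ)) : Prop :=
  F.Nonempty ∧ (∀ ⦃A B : Set ℕ⦄, A ∈ F → A ⊆ B → B ∈ F) ∧ ∅ ∉ F

/-- `T` is `F`-transitive. -/
def FTrans {X : Type*} [TopologicalSpace X] (T : X → X) (F : Set (Set ℕ)) : Prop :=
  ∀ U V : Set X, IsOpen U → IsOpen V → U.Nonempty → V.Nonempty → nset T U V ∈ F

/-- Direct sum (product) of two maps. -/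
def prodMap' {X Y : Type*} (T : X → X) (S : Y → Y) : X × Y → X × Y :=
  fun p => (T p.1, S p.2)

/-- `T` is `F`-mixing: `T × T` is `F`-transitive. -/
def FMix {X : Type*} [TopologicalSpace X] (T : X → X) (F : Set (Set ℕ)) : Prop :=
  FTrans (prodMap' T T) F

/-- Topological transitivity. -/
def TopTrans {X : Type*} [TopologicalSpace X] (T : X → X) : Prop :=
  ∀ U V : Set X, IsOpen U → IsOpen V → U.Nonempty → V.Nonempty → (nset T U V).Nonempty

/-- Weak mixing: `T × T` is topologically transitive. -/
def WMix {X : Type*} [TopologicalSpace X] (T : X → X) : Prop :=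
  TopTrans (prodMap' T T)

/-- Hypercyclicity: some point has dense orbit. -/
def HypercyclicMap {X : Type*} [TopologicalSpace X] (T : X → X) : Prop :=
  ∃ x : X, Dense (Set.range fun n : ℕ => T^[n] x)

/-- Weak disjointness: the direct sum is hypercyclic. -/
def WeaklyDisjoint {X Y : Type*} [TopologicalSpace X] [TopologicalSpace Y]
    (T : X → X) (S : Y → Y) : Prop :=
  HypercyclicMap (prodMap' T S)

/-- The family generated by the return time sets of `T`. -/
def NTfam {X : Type*} [TopologicalSpace X] (T : X → X) : Set (Set ℕ) :=
  {A : Set ℕ | ∃ U V : Set X, IsOpen U ∧ IsOpen V ∧ U.Nonempty ∧ V.Nonempty ∧ nset T U V ⊆ A}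

/- ### Combinatorial families -/

/-- `(A + i) ∩ ℕ` for `i : ℤ`. -/
def shiftSet (A : Set ℕ) (i : ℤ) : Set ℕ := {n : ℕ | ∃ m ∈ A, (n : ℤ) = (m : ℤ) + i}

/-- A shift-invariant family. -/
def ShiftInvariant (F : Set (Set ℕ)) : Prop := ∀ A ∈ F, ∀ i : ℤ, shiftSet A i ∈ F

/-- A shift₊-invariant family: `A + i ∈ F` for `i : ℕ`. -/
def ShiftPlusInvariant (F : Set (Set ℕ)) : Prop :=
  ∀ A ∈ F, ∀ i : ℕ, (fun n => n + i) '' A ∈ F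

/-- A thick family: `⋂_{i=0}^{k} ((A - i) ∩ ℕ) ∈ F` for all `A ∈ F`, `k ∈ ℕ`. -/
def ThickFamily (F : Set (Set ℕ)) : Prop :=
  ∀ A ∈ F, ∀ k : ℕ, {n : ℕ | ∀ i ≤ k, n + i ∈ A} ∈ F

/-- The dual family `F*`. -/
def dualFam (F : Set (Set ℕ)) : Set (Set ℕ) := {A | ∀ B ∈ F, (A ∩ B).Nonempty}

/-- A full family. -/
def FullFamily (F : Set (Set ℕ)) : Prop :=
  ∀ A ∈ F, ∀ B ∈ dualFam F, (A ∩ B).Infinite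

/-- `F̃`: the members `A` of `F` with `⋂_{i=-k}^{k} ((A + i) ∩ ℕ) ∈ F` for all `k ∈ ℕ`. -/
def tildeFam (F : Set (Set ℕ)) : Set (Set ℕ) :=
  {A ∈ F | ∀ k : ℕ, {n : ℕ | ∀ i : ℤ, |i| ≤ (k : ℤ) → n ∈ shiftSet A i} ∈ F}

/-- A thick subset of `ℕ`: contains arbitrarily long blocks of consecutive integers. -/
def IsThickSet (A : Set ℕ) : Prop := ∀ k : ℕ, ∃ n : ℕ, ∀ i ≤ k, n + i ∈ A

/-- A syndetic subset of `ℕ` (bounded gaps). -/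
def IsSyndetic (A : Set ℕ) : Prop := ∃ g : ℕ, ∀ n : ℕ, ∃ m ∈ A, n ≤ m ∧ m ≤ n + g

/-- A piecewise syndetic subset: intersection of a syndetic and a thick set. -/
def IsPiecewiseSyndetic (A : Set ℕ) : Prop :=
  ∃ S T : Set ℕ, IsSyndetic S ∧ IsThickSet T ∧ A = S ∩ T

/-- An IP-set. -/
def IsIPSet (A : Set ℕ) : Prop :=
  ∃ x : ℕ → ℕ, {n | x n ≠ 0}.Infinite ∧ ∀ s : Finset ℕ, s.Nonempty → (∑ i ∈ s, x i) ∈ A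

/-- `(A - A) ∩ ℕ` for `A ⊆ ℕ`: positive differences of distinct elements. -/
def diffSet (A : Set ℕ) : Set ℕ := {k | ∃ m ∈ A, ∃ n ∈ A, n < m ∧ k = m - n}

/-- The family `Δ*_ip`. -/
def deltaIPStar : Set (Set ℕ) :=
  {A | ∀ F : Set ℕ, IsIPSet F → (A ∩ diffSet F).Nonempty}

/- ### Operators on Fréchet spaces -/

/-- A (continuous linear) operator on an infinite-dimensional separable Fréchet space
(a complete metrizable locally convex topological vector space) over `ℝ` or `ℂ`
(an `RCLike` field). -/
structure FrechetOp where
  𝕜 : Type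
  [instField : RCLike 𝕜]
  X : Type
  [instAdd : AddCommGroup X]
  [instMod : Module 𝕜 X]
  [instUnif : UniformSpace X]
  [instUAG : IsUniformAddGroup X]
  [instSMul : ContinuousSMul 𝕜 X]
  [instComplete : CompleteSpace X]
  [instMetrizable : TopologicalSpace.MetrizableSpace X]
  [instSeparable : TopologicalSpace.SeparableSpace X]
  [instModR : Module ℝ X]
  [instTower : IsScalarTower ℝ 𝕜 X]
  [instLC : LocallyConvexSpace ℝ X]
  infDim : ¬ FiniteDimensional 𝕜 X
  T : X → X
  linear : IsLinearMap 𝕜 T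
  cont : Continuous T

attribute [instance] FrechetOp.instAdd FrechetOp.instMod
  FrechetOp.instUnif FrechetOp.instUAG FrechetOp.instSMul FrechetOp.instComplete
  FrechetOp.instMetrizable FrechetOp.instSeparable FrechetOp.instModR
  FrechetOp.instTower FrechetOp.instLC

/-- A bundled Fréchet-space operator is hypercyclic. -/
def FrechetOp.Hypercyclic (S : FrechetOp) : Prop := HypercyclicMap S.T

/-- A bundled Fréchet-space operator is invertible (a linear homeomorphism). -/
def FrechetOp.Invertible (S : FrechetOp) : Prop :=
  ∃ T' : S.X → S.X, Continuous T' ∧ (∀ x, T' (S.T x) = x) ∧ (∀ x, S.T (T' x) = x)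

/-- Mild mixing: weakly disjoint from every hypercyclic operator
(on every infinite-dimensional separable Fréchet space). -/
def MildlyMixing {X : Type*} [TopologicalSpace X] (T : X → X) : Prop :=
  ∀ S : FrechetOp, S.Hypercyclic → WeaklyDisjoint T S.T

/-- Topological ergodicity: all return time sets are syndetic. -/
def TopErgodic {X : Type*} [TopologicalSpace X] (T : X → X) : Prop :=
  ∀ U V : Set X, IsOpen U → IsOpen V → U.Nonempty → V.Nonempty → IsSyndetic (nset T U V)

/-- The `F`-Mixing Criterion for a map `T`. -/
def FMixCriterion {X : Type*} [TopologicalSpace X] [Zero X] (T : X → X)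
    (F : Set (Set ℕ)) : Prop :=
  ∃ X₀ Y₀ : Set X, Dense X₀ ∧ Dense Y₀ ∧ ∃ S : ℕ → X → X,
    ∀ x₀ ∈ X₀, ∀ y₀ ∈ Y₀, ∀ O ∈ nhds ((0, 0, y₀) : X × X × X),
      {n : ℕ | (T^[n] x₀, S n y₀, T^[n] (S n y₀)) ∈ O} ∈ F

/- ### Bilateral weighted backward shifts on `ℓᵖ(ℤ)` and `c₀(ℤ)` -/

/-- `B` is the bilateral weighted backward shift with (positive, bounded) weight `w` on
`ℓᵖ(ℤ)`; the condition that `1/w` is bounded makes it invertible. -/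
def IsInvertibleWBSlp (𝕜 : Type) [RCLike 𝕜] (p : ℝ≥0∞) [Fact (1 ≤ p)] (w : ℤ → ℝ)
    (B : lp (fun _ : ℤ => 𝕜) p →L[𝕜] lp (fun _ : ℤ => 𝕜) p) : Prop :=
  (∀ n, 0 < w n) ∧ (∃ C : ℝ, ∀ n, w n ≤ C) ∧ (∃ c : ℝ, 0 < c ∧ ∀ n, c ≤ w n) ∧
    ∀ (x : lp (fun _ : ℤ => 𝕜) p) (n : ℤ), B x n = w (n + 1) • x (n + 1)

/-- `B` is the bilateral weighted backward shift with (positive, bounded) weight `w` on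
`c₀(ℤ)`; the condition that `1/w` is bounded makes it invertible. -/
def IsInvertibleWBSc0 (𝕜 : Type) [RCLike 𝕜] (w : ℤ → ℝ)
    (B : ZeroAtInftyContinuousMap ℤ 𝕜 →L[𝕜] ZeroAtInftyContinuousMap ℤ 𝕜) : Prop :=
  (∀ n, 0 < w n) ∧ (∃ C : ℝ, ∀ n, w n ≤ C) ∧ (∃ c : ℝ, 0 < c ∧ ∀ n, c ≤ w n) ∧
    ∀ (x : ZeroAtInftyContinuousMap ℤ 𝕜) (n : ℤ), B x n = w (n + 1) • x (n + 1)

/- ### Combinatorics -/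

/-- Thickly syndetic sets. -/
def ThickSyn (A : Set ℕ) : Prop := ∀ k : ℕ, IsSyndetic {n : ℕ | ∀ i ≤ k, n + i ∈ A}

theorem IsSyndetic.mono' {A B : Set ℕ} (h : IsSyndetic A) (hAB : A ⊆ B) : IsSyndetic B := by
  obtain ⟨g, hg⟩ := h
  refine ⟨g, fun n => ?_⟩
  obtain ⟨m, hm, h1, h2⟩ := hg n
  exact ⟨m, hAB hm, h1, h2⟩

theorem ThickSyn.mono' {A B : Set ℕ} (h : ThickSyn A) (hAB : A ⊆ B) : ThickSyn B :=
  fun k => (h k).mono' fun _ hn i hi => hAB (hn i hi)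

theorem ThickSyn.inter' {A B : Set ℕ} (hA : ThickSyn A) (hB : ThickSyn B) :
    ThickSyn (A ∩ B) := by
  intro k
  obtain ⟨b, hb⟩ := hB k
  obtain ⟨a, ha⟩ := hA (b + k)
  refine ⟨a + b, fun n => ?_⟩
  obtain ⟨m, hm, h1, h2⟩ := ha n
  obtain ⟨l, hl, h3, h4⟩ := hb m
  refine ⟨l, fun i hi => ⟨?_, hl i hi⟩, by omega, by omega⟩
  have := hm (l - m + i) (by omega)
  rwa [show m + (l - m + i) = l + i by omega] at this

theorem ThickSyn.meets {A B : Set ℕ} (hA : ThickSyn A) (hB : IsPiecewiseSyndetic B) :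
    (B ∩ A).Nonempty := by
  obtain ⟨S, R, ⟨g, hg⟩, hR, rfl⟩ := hB
  obtain ⟨a, ha⟩ := hA g
  obtain ⟨n, hn⟩ := hR (a + g)
  obtain ⟨m, hm, h1, h2⟩ := ha n
  obtain ⟨l, hl, h3, h4⟩ := hg m
  refine ⟨l, ⟨hl, ?_⟩, ?_⟩
  · have := hn (l - n) (by omega)
    rwa [show n + (l - n) = l by omega] at this
  · have := hm (l - m) (by omega)
    rwa [show m + (l - m) = l by omega] at this

theorem thickSyn_compl_of_not_ps {A : Set ℕ} (h : ¬ IsPiecewiseSyndetic A) :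
    ThickSyn Aᶜ := by
  by_contra hc
  apply h
  simp only [ThickSyn, not_forall] at hc
  obtain ⟨k, hk⟩ := hc
  refine ⟨A ∪ {m | ∃ i ≤ k, m + i ∈ A}ᶜ, {m | ∃ i ≤ k, m + i ∈ A}, ⟨k, fun n => ?_⟩, ?_, ?_⟩
  · by_cases hn : ∃ i ≤ k, n + i ∈ A
    · obtain ⟨i, hi, hA⟩ := hn
      exact ⟨n + i, Or.inl hA, by omega, by omega⟩
    · exact ⟨n, Or.inr hn, by omega, by omega⟩
  · intro g
    by_contra hg
    apply hk
    refine ⟨g, fun n => ?_⟩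
    push Not at hg
    obtain ⟨i, hi, hi2⟩ := hg n
    refine ⟨n + i, fun j hj hA => hi2 ?_, by omega, by omega⟩
    exact ⟨j, hj, hA⟩
  · ext m
    constructor
    · intro hm
      exact ⟨Or.inl hm, 0, by omega, by simpa using hm⟩
    · rintro ⟨hm | hm, h2⟩
      · exact hm
      · exact absurd h2 hm

/- ### Topologically ergodic operators have thickly syndetic return sets -/

theorem iterate_add_of_additive {X : Type*} [Add X] {S : X → X}
    (hS : ∀ x y, S (x + y) = S x + S y) (n : ℕ) (x y : X) :
    S^[n] (x + y) = S^[n] x + S^[n] y := by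
  induction n generalizing x y with
  | zero => rfl
  | succ n ih => simp only [Function.iterate_succ_apply, hS, ih]

theorem topErgodic_thickSyn {X : Type*} [AddCommGroup X] [TopologicalSpace X]
    [IsTopologicalAddGroup X] {S : X → X} (hS : ∀ x y, S (x + y) = S x + S y)
    (hc : Continuous S) (hE : TopErgodic S) {U V : Set X} (hU : IsOpen U) (hV : IsOpen V)
    (hU' : U.Nonempty) (hV' : V.Nonempty) : ThickSyn (nset S U V) := by
  have hS0 : S 0 = 0 := by simpa using hS 0 0
  have hit0 : ∀ n, S^[n] 0 = 0 := fun n => Function.iterate_fixed hS0 n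
  -- return sets to and from a neighbourhood of zero
  have key : ∀ W : Set X, IsOpen W → (0 : X) ∈ W → ∀ k : ℕ,
      ∃ W' : Set X, IsOpen W' ∧ (0 : X) ∈ W' ∧ ∀ i ≤ k, ∀ x ∈ W', S^[i] x ∈ W := by
    intro W hW h0 k
    refine ⟨⋂ i ∈ Set.Iic k, S^[i] ⁻¹' W, ?_, ?_, ?_⟩
    · exact (Set.finite_Iic k).isOpen_biInter fun i _ => hW.preimage (hc.iterate i)
    · simp [hit0, h0]
    · intro i hi x hx
      simp only [Set.mem_iInter] at hx
      exact hx i hi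
  have h1 : ∀ W : Set X, IsOpen W → (0 : X) ∈ W → ∀ U : Set X, IsOpen U → U.Nonempty →
      ThickSyn (nset S U W) := by
    intro W hW h0 U hU hU' k
    obtain ⟨W', hW', h0', hk⟩ := key W hW h0 k
    refine (hE U W' hU hW' hU' ⟨0, h0'⟩).mono' ?_
    rintro n ⟨x, hx, hxn⟩ i hi
    refine ⟨x, hx, ?_⟩
    rw [add_comm, Function.iterate_add_apply]
    exact hk i hi _ hxn
  have h2 : ∀ W : Set X, IsOpen W → (0 : X) ∈ W → ∀ V : Set X, IsOpen V → V.Nonempty →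
      ThickSyn (nset S W V) := by
    intro W hW h0 V hV hV' k
    obtain ⟨W', hW', h0', hk⟩ := key W hW h0 k
    obtain ⟨g, hg⟩ := hE W' V hW' hV ⟨0, h0'⟩ hV'
    refine ⟨g, fun n => ?_⟩
    obtain ⟨m, ⟨x, hx, hxm⟩, hm1, hm2⟩ := hg (n + k)
    refine ⟨m - k, fun i hi => ⟨S^[k - i] x, hk _ (by omega) x hx, ?_⟩, by omega, by omega⟩
    rw [← Function.iterate_add_apply, show m - k + i + (k - i) = m by omega]
    exact hxm
  obtain ⟨u, hu⟩ := hU'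
  obtain ⟨v, hv⟩ := hV'
  have hadd : Continuous fun p : X × X => p.1 + p.2 := continuous_add
  obtain ⟨U₁, W₁, hU₁, hW₁, hu₁, h01, hs1⟩ :=
    isOpen_prod_iff.1 (hU.preimage hadd) u 0 (by simpa using hu)
  obtain ⟨V₁, W₂, hV₁, hW₂, hv₁, h02, hs2⟩ :=
    isOpen_prod_iff.1 (hV.preimage hadd) v 0 (by simpa using hv)
  have hW : IsOpen (W₁ ∩ W₂) := hW₁.inter hW₂
  refine ((h1 _ hW ⟨h01, h02⟩ U₁ hU₁ ⟨u, hu₁⟩).inter'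
    (h2 _ hW ⟨h01, h02⟩ V₁ hV₁ ⟨v, hv₁⟩)).mono' ?_
  rintro n ⟨⟨x, hx, hxn⟩, ⟨y, hy, hyn⟩⟩
  refine ⟨x + y, hs1 (Set.mk_mem_prod hx hy.1), ?_⟩
  rw [iterate_add_of_additive hS, add_comm]
  exact hs2 (Set.mk_mem_prod hyn hxn.2)

/- ### Birkhoff transitivity -/

theorem hypercyclic_of_topTrans {X : Type*} [TopologicalSpace X] [BaireSpace X]
    [SecondCountableTopology X] [Nonempty X] {f : X → X} (hf : Continuous f)
    (h : TopTrans f) : HypercyclicMap f := by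
  let b := TopologicalSpace.countableBasis X
  have hb : b.Countable := TopologicalSpace.countable_countableBasis X
  have hB : TopologicalSpace.IsTopologicalBasis b := TopologicalSpace.isBasis_countableBasis X
  have hd : Dense (⋂ V ∈ b, ⋃ n : ℕ, f^[n] ⁻¹' V) := by
    refine dense_biInter_of_isOpen ?_ hb ?_
    · intro V hV
      exact isOpen_iUnion fun n => (hB.isOpen hV).preimage (hf.iterate n)
    · intro V hV
      rw [dense_iff_inter_open]
      intro U hU hU'
      obtain ⟨n, x, hx, hxn⟩ := h U V hU (hB.isOpen hV) hU'
        (TopologicalSpace.nonempty_of_mem_countableBasis hV)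
      exact ⟨x, hx, Set.mem_iUnion.2 ⟨n, hxn⟩⟩
  obtain ⟨x, hx⟩ := hd.nonempty
  refine ⟨x, hB.dense_iff.2 fun V hV _ => ?_⟩
  simp only [Set.mem_iInter] at hx
  obtain ⟨n, hn⟩ := Set.mem_iUnion.1 (hx V hV)
  exact ⟨f^[n] x, hn, n, rfl⟩

theorem prodMap'_iterate {X Y : Type*} (T : X → X) (S : Y → Y) (n : ℕ) (p : X × Y) :
    (prodMap' T S)^[n] p = (T^[n] p.1, S^[n] p.2) := by
  induction n generalizing p with
  | zero => rfl
  | succ n ih => simp only [Function.iterate_succ_apply, ih, prodMap']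

theorem weaklyDisjoint_of_ps (T : FrechetOp)
    (hT : FTrans T.T {A : Set ℕ | IsPiecewiseSyndetic A})
    {Y : Type*} [AddCommGroup Y] [UniformSpace Y] [IsUniformAddGroup Y] [CompleteSpace Y]
    [TopologicalSpace.MetrizableSpace Y] [TopologicalSpace.SeparableSpace Y]
    {S : Y → Y} (hS : ∀ x y, S (x + y) = S x + S y) (hc : Continuous S)
    (hE : TopErgodic S) : WeaklyDisjoint T.T S := by
  have : (uniformity T.X).IsCountablyGenerated :=
    IsUniformAddGroup.uniformity_countably_generated
  have : (uniformity Y).IsCountablyGenerated :=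
    IsUniformAddGroup.uniformity_countably_generated
  refine hypercyclic_of_topTrans ?_ ?_
  · exact (T.cont.comp continuous_fst).prodMk (hc.comp continuous_snd)
  · rintro U V hU hV ⟨⟨u1, u2⟩, hu⟩ ⟨⟨v1, v2⟩, hv⟩
    obtain ⟨U₁, U₂, hU₁, hU₂, hu₁, hu₂, hsU⟩ := isOpen_prod_iff.1 hU u1 u2 hu
    obtain ⟨V₁, V₂, hV₁, hV₂, hv₁, hv₂, hsV⟩ := isOpen_prod_iff.1 hV v1 v2 hv
    obtain ⟨n, ⟨x, hx, hxn⟩, ⟨y, hy, hyn⟩⟩ :=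
      (topErgodic_thickSyn hS hc hE hU₂ hV₂ ⟨u2, hu₂⟩ ⟨v2, hv₂⟩).meets
        (hT U₁ V₁ hU₁ hV₁ ⟨u1, hu₁⟩ ⟨v1, hv₁⟩)
    refine ⟨n, (x, y), hsU (Set.mk_mem_prod hx hy), ?_⟩
    rw [prodMap'_iterate]
    exact hsV (Set.mk_mem_prod hxn hyn)

/- ### Separability of the sequence spaces -/

theorem lp_separable (𝕜 : Type) [RCLike 𝕜] (p : ℝ≥0∞) [Fact (1 ≤ p)] (hp : p ≠ ∞) :
    TopologicalSpace.SeparableSpace (lp (fun _ : ℤ => 𝕜) p) := by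
  have h1 : TopologicalSpace.IsSeparable
      (Set.range fun i : ℤ => (lp.single p i (1 : 𝕜) : lp (fun _ : ℤ => 𝕜) p)) :=
    (Set.countable_range _).isSeparable
  have h2 := (h1.span (R := 𝕜)).closure
  rw [← TopologicalSpace.isSeparable_univ_iff]
  refine h2.mono fun x _ => ?_
  refine mem_closure_of_tendsto (lp.hasSum_single hp x) (Eventually.of_forall fun s => ?_)
  refine Submodule.sum_mem _ fun i _ => ?_
  have : (lp.single p i (x i) : lp (fun _ : ℤ => 𝕜) p) = x i • lp.single p i (1 : 𝕜) := by
    rw [← lp.single_smul]; simp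
  rw [this]
  exact Submodule.smul_mem _ _ (Submodule.subset_span ⟨i, rfl⟩)

/-- Finitely supported elements of `c₀(ℤ)`. -/
noncomputable def c0fin (𝕜 : Type) [RCLike 𝕜] (s : Finset ℤ) (f : ℤ → 𝕜) :
    ZeroAtInftyContinuousMap ℤ 𝕜 where
  toFun n := if n ∈ s then f n else 0
  continuous_toFun := continuous_of_discreteTopology
  zero_at_infty' := by
    rw [Filter.cocompact_eq_cofinite]
    refine tendsto_const_nhds.congr' ?_
    filter_upwards [s.finite_toSet.compl_mem_cofinite] with n hn
    have : n ∉ s := by simpa using hn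
    simp [this]

theorem c0_separable (𝕜 : Type) [RCLike 𝕜] :
    TopologicalSpace.SeparableSpace (ZeroAtInftyContinuousMap ℤ 𝕜) := by
  have h1 : TopologicalSpace.IsSeparable
      (Set.range fun i : ℤ => c0fin 𝕜 {i} (fun _ => 1)) :=
    (Set.countable_range _).isSeparable
  have h2 := (h1.span (R := 𝕜)).closure
  rw [← TopologicalSpace.isSeparable_univ_iff]
  refine h2.mono fun x _ => ?_
  rw [Metric.mem_closure_iff]
  intro ε hε
  have hx := x.zero_at_infty'
  rw [Filter.cocompact_eq_cofinite] at hx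
  have hfin : {n : ℤ | ¬ ‖x n‖ < ε / 2}.Finite := by
    have := hx.norm.eventually (gt_mem_nhds (show ‖(0 : 𝕜)‖ < ε / 2 by simpa using half_pos hε))
    exact Filter.eventually_cofinite.1 this
  have hmem : ∀ s : Finset ℤ, c0fin 𝕜 s x ∈
      Submodule.span 𝕜 (Set.range fun i : ℤ => c0fin 𝕜 {i} (fun _ => 1)) := by
    intro s
    induction s using Finset.induction_on with
    | empty =>
      have : c0fin 𝕜 ∅ x = 0 := by ext n; simp [c0fin]
      rw [this]; exact Submodule.zero_mem _
    | insert a s ha ih =>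
      have : c0fin 𝕜 (insert a s) x = x a • c0fin 𝕜 {a} (fun _ => 1) + c0fin 𝕜 s x := by
        ext n
        by_cases hn : n = a
        · subst hn; simp [c0fin, ha]
        · simp [c0fin, hn]
      rw [this]
      exact Submodule.add_mem _ (Submodule.smul_mem _ _ (Submodule.subset_span ⟨a, rfl⟩)) ih
  refine ⟨c0fin 𝕜 hfin.toFinset x, hmem _, lt_of_le_of_lt ?_ (half_lt_self hε)⟩
  rw [← ZeroAtInftyContinuousMap.dist_toBCF_eq_dist,
    BoundedContinuousFunction.dist_le (half_pos hε).le]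
  intro n
  change dist (x n) (if n ∈ hfin.toFinset then x n else 0) ≤ ε / 2
  by_cases hn : ‖x n‖ < ε / 2
  · have : n ∉ hfin.toFinset := by simpa using hn
    rw [if_neg this, dist_zero_right]; exact hn.le
  · have : n ∈ hfin.toFinset := by simpa using hn
    rw [if_pos this, dist_self]; exact (half_pos hε).le

/- ### The weighted shift -/

/-- The space `ℓ¹(ℤ)` over the reals. -/
abbrev L1Z : Type := lp (fun _ : ℤ => ℝ) 1

theorem L1Z_summable (x : L1Z) : Summable fun n : ℤ => ‖x n‖ := by
  have := (lp.memℓp x).summable (by simp)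
  simpa using this

theorem L1Z_norm (x : L1Z) : ‖x‖ = ∑' n : ℤ, ‖x n‖ := by
  have := lp.norm_eq_tsum_rpow (p := 1) (by simp) x
  simpa using this

/-- The weight attached to a potential. -/
noncomputable def wt (φ : ℤ → ℝ) (n : ℤ) : ℝ := Real.exp (φ n - φ (n - 1))

theorem wt_pos (φ : ℤ → ℝ) (n : ℤ) : 0 < wt φ n := Real.exp_pos _

theorem wt_le {φ : ℤ → ℝ} (hφ : ∀ m n : ℤ, |φ m - φ n| ≤ |(m : ℝ) - n|) (n : ℤ) :
    wt φ n ≤ Real.exp 1 := by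
  refine Real.exp_le_exp.2 ?_
  have := hφ n (n - 1)
  push_cast at this
  rw [show (n : ℝ) - (n - 1) = 1 by ring, abs_one] at this
  exact (abs_le.1 this).2

theorem le_wt {φ : ℤ → ℝ} (hφ : ∀ m n : ℤ, |φ m - φ n| ≤ |(m : ℝ) - n|) (n : ℤ) :
    Real.exp (-1) ≤ wt φ n := by
  refine Real.exp_le_exp.2 ?_
  have := hφ n (n - 1)
  push_cast at this
  rw [show (n : ℝ) - (n - 1) = 1 by ring, abs_one] at this
  exact (abs_le.1 this).1

theorem shift_summable (x : L1Z) : Summable fun n : ℤ => ‖x (n + 1)‖ :=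
  (Equiv.addRight (1 : ℤ)).summable_iff.2 (L1Z_summable x)

theorem wshift_bound {φ : ℤ → ℝ} (hφ : ∀ m n : ℤ, |φ m - φ n| ≤ |(m : ℝ) - n|) (x : L1Z)
    (n : ℤ) : ‖wt φ (n + 1) * x (n + 1)‖ ≤ Real.exp 1 * ‖x (n + 1)‖ := by
  rw [norm_mul, Real.norm_of_nonneg (wt_pos φ _).le]
  exact mul_le_mul_of_nonneg_right (wt_le hφ _) (norm_nonneg _)

theorem wshift_summable {φ : ℤ → ℝ} (hφ : ∀ m n : ℤ, |φ m - φ n| ≤ |(m : ℝ) - n|) (x : L1Z) :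
    Summable fun n : ℤ => ‖wt φ (n + 1) * x (n + 1)‖ :=
  Summable.of_nonneg_of_le (fun _ => norm_nonneg _) (wshift_bound hφ x)
    ((shift_summable x).mul_left _)

/-- The weighted backward shift on `ℓ¹(ℤ)`. -/
noncomputable def wshift (φ : ℤ → ℝ) (hφ : ∀ m n : ℤ, |φ m - φ n| ≤ |(m : ℝ) - n|) :
    L1Z →L[ℝ] L1Z :=
  LinearMap.mkContinuous
    { toFun := fun x => ⟨fun n => wt φ (n + 1) * x (n + 1), by
        refine memℓp_gen ?_
        simpa using wshift_summable hφ x⟩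
      map_add' := fun x y => by
        ext n
        change wt φ (n + 1) * (x (n + 1) + y (n + 1)) = wt φ (n + 1) * x (n + 1) +
          wt φ (n + 1) * y (n + 1)
        ring
      map_smul' := fun c x => by
        ext n
        change wt φ (n + 1) * (c * x (n + 1)) = c * (wt φ (n + 1) * x (n + 1))
        ring }
    (Real.exp 1) (by
      intro x
      rw [L1Z_norm, L1Z_norm, ← (Equiv.addRight (1 : ℤ)).tsum_eq (fun n => ‖x n‖), ← tsum_mul_left]
      exact (wshift_summable hφ x).tsum_le_tsum (wshift_bound hφ x)
        ((shift_summable x).mul_left _))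

theorem wshift_apply (φ : ℤ → ℝ) (hφ : ∀ m n : ℤ, |φ m - φ n| ≤ |(m : ℝ) - n|) (x : L1Z)
    (n : ℤ) : wshift φ hφ x n = wt φ (n + 1) * x (n + 1) := rfl

theorem wshift_iterate (φ : ℤ → ℝ) (hφ : ∀ m n : ℤ, |φ m - φ n| ≤ |(m : ℝ) - n|) (k : ℕ)
    (x : L1Z) (n : ℤ) :
    ((wshift φ hφ)^[k] x) n = Real.exp (φ (n + k) - φ n) * x (n + k) := by
  induction k generalizing x n with
  | zero => simp
  | succ k ih =>
    rw [Function.iterate_succ_apply, ih, wshift_apply, wt, ← mul_assoc, ← Real.exp_add]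
    have e1 : n + (k : ℤ) + 1 - 1 = n + k := by ring
    have e2 : n + ((k + 1 : ℕ) : ℤ) = n + k + 1 := by push_cast; ring
    rw [e1, e2]
    congr 2
    ring

theorem wshift_iterate_single (φ : ℤ → ℝ) (hφ : ∀ m n : ℤ, |φ m - φ n| ≤ |(m : ℝ) - n|) (k : ℕ)
    (j : ℤ) (a : ℝ) :
    (wshift φ hφ)^[k] (lp.single 1 j a : L1Z) =
      (lp.single 1 (j - k) (Real.exp (φ j - φ (j - k)) * a) : L1Z) := by
  ext n
  rw [wshift_iterate]
  by_cases h : n = j - k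
  · subst h
    rw [lp.single_apply_self, sub_add_cancel, lp.single_apply_self]
  · rw [lp.single_apply_ne _ _ _ h, lp.single_apply_ne _ _ _ (by omega), mul_zero]

/-- The filter of times at which the potential is large. -/
def potFilter (φ : ℤ → ℝ) : Filter ℕ := Filter.comap (fun n : ℕ => φ n) atTop

theorem tendsto_potFilter (φ : ℤ → ℝ) : Tendsto (fun n : ℕ => φ n) (potFilter φ) atTop :=
  Filter.tendsto_comap

theorem wshift_nset_mem (φ : ℤ → ℝ) (hφ : ∀ m n : ℤ, |φ m - φ n| ≤ |(m : ℝ) - n|)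
    (hev : ∀ n, φ (-n) = φ n) {U V : Set L1Z} (hU : IsOpen U) (hV : IsOpen V)
    (hU' : U.Nonempty) (hV' : V.Nonempty) :
    nset (wshift φ hφ) U V ∈ potFilter φ := by
  set B := wshift φ hφ with hB
  have hadd : ∀ (n : ℕ) (x y : L1Z), B^[n] (x + y) = B^[n] x + B^[n] y :=
    iterate_add_of_additive (fun x y => map_add B x y)
  have hzero : ∀ n : ℕ, B^[n] 0 = 0 := fun n => Function.iterate_fixed (map_zero B) n
  -- `φ (j ± n)` is large along the filter
  have hsub : ∀ j : ℤ, Tendsto (fun n : ℕ => φ (j - n)) (potFilter φ) atTop := by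
    intro j
    refine tendsto_atTop_mono (fun n => ?_)
      (tendsto_atTop_add_const_right _ (-|(j : ℝ)|) (tendsto_potFilter φ))
    have h := hφ (j - n) (-n)
    rw [hev] at h
    push_cast at h
    rw [show (j : ℝ) - n - -n = j by ring] at h
    linarith [(abs_le.1 h).1]
  have hadd' : ∀ j : ℤ, Tendsto (fun n : ℕ => φ (j + n)) (potFilter φ) atTop := by
    intro j
    refine tendsto_atTop_mono (fun n => ?_)
      (tendsto_atTop_add_const_right _ (-|(j : ℝ)|) (tendsto_potFilter φ))
    have h := hφ (j + n) n
    push_cast at h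
    rw [show (j : ℝ) + n - n = j by ring] at h
    linarith [(abs_le.1 h).1]
  have hexp : ∀ (c a : ℝ) (g : ℕ → ℝ), Tendsto g (potFilter φ) atTop →
      Tendsto (fun n => Real.exp (c - g n) * a) (potFilter φ) (𝓝 0) := by
    intro c a g hg
    have h1 : Tendsto (fun n => c - g n) (potFilter φ) atBot :=
      tendsto_atBot_add_const_left _ c (tendsto_neg_atTop_atBot.comp hg)
    simpa using (Real.tendsto_exp_atBot.comp h1).mul_const a
  have hnorm : ∀ (i : ℕ → ℤ) (a : ℕ → ℝ), Tendsto a (potFilter φ) (𝓝 0) →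
      Tendsto (fun n => (lp.single 1 (i n) (a n) : L1Z)) (potFilter φ) (𝓝 0) := by
    intro i a ha
    rw [tendsto_zero_iff_norm_tendsto_zero]
    simp only [lp.norm_single (E := fun _ : ℤ => ℝ) (zero_lt_one : (0 : ℝ≥0∞) < 1)]
    simpa using ha.norm
  have hP : ∀ (f : ℤ → ℝ) (s : Finset ℤ),
      Tendsto (fun n => B^[n] (∑ i ∈ s, (lp.single 1 i (f i) : L1Z))) (potFilter φ) (𝓝 0) := by
    intro f s
    induction s using Finset.induction_on with
    | empty => simpa [hzero] using tendsto_const_nhds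
    | insert j s hj ih =>
      simp only [Finset.sum_insert hj, hadd]
      rw [← add_zero (0 : L1Z)]
      refine Tendsto.add ?_ ih
      simp only [hB, wshift_iterate_single]
      exact hnorm _ _ (hexp _ _ _ (hsub j))
  have hQ : ∀ (f : ℤ → ℝ) (s : Finset ℤ), ∃ z : ℕ → L1Z, Tendsto z (potFilter φ) (𝓝 0) ∧
      ∀ n, B^[n] (z n) = ∑ i ∈ s, (lp.single 1 i (f i) : L1Z) := by
    intro f s
    induction s using Finset.induction_on with
    | empty => exact ⟨fun _ => 0, tendsto_const_nhds, fun n => by simp [hzero]⟩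
    | insert j s hj ih =>
      obtain ⟨z, hz, hzB⟩ := ih
      refine ⟨fun n => lp.single 1 (j + n) (Real.exp (φ j - φ (j + n)) * f j) + z n, ?_, ?_⟩
      · rw [← add_zero (0 : L1Z)]
        exact (hnorm _ _ (hexp _ _ _ (hadd' j))).add hz
      · intro n
        rw [Finset.sum_insert hj, hadd, hzB, hB, wshift_iterate_single, add_sub_cancel_right,
          ← mul_assoc, ← Real.exp_add]
        simp
  have hdense : ∀ U : Set L1Z, IsOpen U → U.Nonempty → ∃ (f : ℤ → ℝ) (s : Finset ℤ),
      ∑ i ∈ s, (lp.single 1 i (f i) : L1Z) ∈ U := by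
    rintro U hU ⟨x, hx⟩
    have := (lp.hasSum_single (E := fun _ : ℤ => ℝ) (p := 1) (by simp) x).eventually
      (hU.mem_nhds hx)
    obtain ⟨s, hs⟩ := this.exists
    exact ⟨x, s, hs⟩
  obtain ⟨f, s, hfU⟩ := hdense U hU hU'
  obtain ⟨g, t, hgV⟩ := hdense V hV hV'
  obtain ⟨z, hz, hzB⟩ := hQ g t
  have e1 : Tendsto (fun n => ∑ i ∈ s, (lp.single 1 i (f i) : L1Z) + z n) (potFilter φ)
      (𝓝 (∑ i ∈ s, (lp.single 1 i (f i) : L1Z))) := by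
    simpa using hz.const_add (∑ i ∈ s, (lp.single 1 i (f i) : L1Z))
  have e2 : Tendsto (fun n => B^[n] (∑ i ∈ s, (lp.single 1 i (f i) : L1Z) + z n)) (potFilter φ)
      (𝓝 (∑ i ∈ t, (lp.single 1 i (g i) : L1Z))) := by
    simp only [hadd, hzB]
    simpa using (hP f s).add_const (∑ i ∈ t, (lp.single 1 i (g i) : L1Z))
  filter_upwards [e1.eventually (hU.mem_nhds hfU), e2.eventually (hV.mem_nhds hgV)] with n h1 h2
  exact ⟨_, h1, h2⟩

/-- For `A` with thickly syndetic complement there is a topologically ergodic invertible weighted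
shift one of whose return sets misses `A`. -/
theorem exists_wshift (A : Set ℕ) (hA : ThickSyn Aᶜ) :
    ∃ (w : ℤ → ℝ) (B : L1Z →L[ℝ] L1Z), IsInvertibleWBSlp ℝ 1 w B ∧ TopErgodic ⇑B ∧
      ∃ U V : Set L1Z, IsOpen U ∧ IsOpen V ∧ U.Nonempty ∧ V.Nonempty ∧
        ∀ n ∈ nset (⇑B) U V, n ∉ A := by
  let E : Set ℤ := {m | m.natAbs ∈ A ∨ m = 0}
  have hE0 : (0 : ℤ) ∈ E := Or.inr rfl
  let φ : ℤ → ℝ := fun m => Metric.infDist m E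
  have hφ : ∀ m n : ℤ, |φ m - φ n| ≤ |(m : ℝ) - n| := by
    intro m n
    have := (Metric.lipschitz_infDist_pt E).dist_le_mul m n
    simpa [Real.dist_eq, Int.dist_eq] using this
  have hzero : ∀ m ∈ E, φ m = 0 := fun m hm => Metric.infDist_zero_of_mem hm
  have hEneg : ∀ m, -m ∈ E ↔ m ∈ E := fun m => by simp [E]
  have hle : ∀ n, φ (-n) ≤ φ n := by
    intro n
    refine (Metric.le_infDist ⟨0, hE0⟩).2 fun {y} hy => ?_
    have := Metric.infDist_le_dist_of_mem (x := -n) ((hEneg y).2 hy)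
    rwa [dist_neg_neg] at this
  have hev : ∀ n, φ (-n) = φ n := fun n => le_antisymm (hle n) (by simpa using hle (-n))
  refine ⟨wt φ, wshift φ hφ, ⟨wt_pos φ, ⟨_, wt_le hφ⟩, ⟨_, Real.exp_pos _, le_wt hφ⟩,
    fun x n => rfl⟩, ?_, ?_⟩
  · intro U V hU hV hU' hV'
    have hmem := wshift_nset_mem φ hφ hev hU hV hU' hV'
    rw [potFilter, Filter.mem_comap] at hmem
    obtain ⟨t, ht, hts⟩ := hmem
    obtain ⟨M, hM⟩ := Filter.mem_atTop_sets.1 ht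
    obtain ⟨K, hK⟩ := exists_nat_ge M
    obtain ⟨g, hg⟩ := hA (2 * K)
    refine IsSyndetic.mono' (A := {n : ℕ | M ≤ φ n}) ?_ fun n hn => hts (hM _ hn)
    refine ⟨g + 1 + K, fun n => ?_⟩
    obtain ⟨m, hm, h1, h2⟩ := hg (n + 1)
    refine ⟨m + K, ?_, by omega, by omega⟩
    refine hK.trans ((Metric.le_infDist ⟨0, hE0⟩).2 fun {y} hy => ?_)
    rw [Int.dist_eq]
    by_contra hlt
    push Not at hlt
    have hlt' : |((m + K : ℕ) : ℤ) - y| < K := by exact_mod_cast hlt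
    rw [abs_lt] at hlt'
    push_cast at hlt'
    rcases hy with hy | hy
    · have := hm (y.natAbs - m) (by omega)
      rw [show m + (y.natAbs - m) = y.natAbs by omega] at this
      exact this hy
    · omega
  · refine ⟨Metric.ball 0 (1 / 2), {x | 1 / 2 < x 0}, Metric.isOpen_ball, ?_, ⟨0, by simp⟩,
      ⟨lp.single 1 0 1, ?_⟩, ?_⟩
    · exact isOpen_lt continuous_const
        (lp.evalCLM ℝ (fun _ : ℤ => ℝ) 1 0).continuous
    · change (1 / 2 : ℝ) < (lp.single 1 0 1 : L1Z) 0
      rw [lp.single_apply_self]; norm_num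
    · rintro n ⟨x, hx, hxn⟩ hn
      change (1 / 2 : ℝ) < _ at hxn
      rw [wshift_iterate, hzero 0 hE0, zero_add, hzero (n : ℤ) (Or.inl (by simpa using hn))] at hxn
      have h1 : ‖x n‖ ≤ ‖x‖ := lp.norm_apply_le_norm (by simp) x n
      rw [mem_ball_zero_iff] at hx
      have h2 := le_abs_self (x (n : ℤ))
      rw [Real.norm_eq_abs] at h1
      simp at hxn
      norm_num at hx
      linarith

theorem L1Z_infDim : ¬ FiniteDimensional ℝ L1Z := by
  intro h
  have hli : LinearIndependent ℝ (fun i : ℤ => (lp.single 1 i (1 : ℝ) : L1Z)) := by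
    rw [linearIndependent_iff']
    intro s g hg i hi
    have := congrArg (lp.evalCLM ℝ (fun _ : ℤ => ℝ) 1 i) hg
    simp only [map_sum, map_smul, map_zero] at this
    rw [Finset.sum_eq_single i] at this
    · have e : lp.evalCLM ℝ (fun _ : ℤ => ℝ) 1 i (lp.single 1 i (1 : ℝ) : L1Z) = 1 :=
        lp.single_apply_self (E := fun _ : ℤ => ℝ) 1 i (1 : ℝ)
      rw [e] at this
      simpa using this
    · intro j _ hj
      have e : lp.evalCLM ℝ (fun _ : ℤ => ℝ) 1 i (lp.single 1 j (1 : ℝ) : L1Z) = 0 :=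
        lp.single_apply_ne (E := fun _ : ℤ => ℝ) 1 j (1 : ℝ) hj.symm
      rw [e, smul_zero]
    · intro h; exact absurd hi h
  have := hli.finite
  exact not_finite ℤ

/-- A continuous linear self-map of `ℓ¹(ℤ)` as a bundled operator. -/
noncomputable def L1Zop (B : L1Z →L[ℝ] L1Z) : FrechetOp :=
  haveI := lp_separable ℝ 1 (by simp)
  { 𝕜 := ℝ
    X := L1Z
    infDim := L1Z_infDim
    T := B
    linear := B.toLinearMap.isLinear
    cont := B.continuous }

/-- Weak disjointness makes return sets meet. -/
theorem nset_meet_of_weaklyDisjoint {X : Type*} [TopologicalSpace X] [T1Space X]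
    {T : X → X} {S : L1Z → L1Z} (h : WeaklyDisjoint T S)
    {U V : Set X} {U' V' : Set L1Z} (hU : IsOpen U) (hV : IsOpen V) (hU' : IsOpen U')
    (hV' : IsOpen V') (nU : U.Nonempty) (nV : V.Nonempty) (nU' : U'.Nonempty)
    (nV' : V'.Nonempty) : (nset T U V ∩ nset S U' V').Nonempty := by
  obtain ⟨p, hp⟩ := h
  have hne : Nontrivial L1Z := by
    refine ⟨0, lp.single 1 0 1, fun h => ?_⟩
    have := congrArg norm h
    rw [lp.norm_single (by simp)] at this
    simp at this
  have hperf : ∀ x : X × L1Z, (𝓝[≠] x).NeBot := by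
    intro x
    have h2 : (𝓝[≠] x.2).NeBot := Module.punctured_nhds_neBot ℝ L1Z x.2
    rw [← mem_closure_iff_nhdsWithin_neBot] at h2 ⊢
    rw [mem_closure_iff] at h2 ⊢
    intro O hO hxO
    obtain ⟨y, hy, hy2⟩ := h2 ((fun y => (x.1, y)) ⁻¹' O)
      (hO.preimage (by fun_prop)) hxO
    exact ⟨(x.1, y), hy, fun h => hy2 (congrArg Prod.snd h)⟩
  obtain ⟨_, hq, n, rfl⟩ := hp.inter_open_nonempty _ (hU.prod hU') (nU.prod nU')
  have hd2 := hp.sdiff_finite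
    (t := (fun n : ℕ => (prodMap' T S)^[n] p) '' Set.Iio n) ((Set.finite_Iio n).image _)
  obtain ⟨_, hr, ⟨m, rfl⟩, hm⟩ := hd2.inter_open_nonempty _ (hV.prod hV') (nV.prod nV')
  have hnm : n ≤ m := by
    by_contra hlt
    exact hm ⟨m, by simpa using hlt, rfl⟩
  simp only [prodMap'_iterate] at hq hr
  refine ⟨m - n, ⟨_, hq.1, ?_⟩, ⟨_, hq.2, ?_⟩⟩
  · rw [← Function.iterate_add_apply, Nat.sub_add_cancel hnm]; exact hr.1
  · rw [← Function.iterate_add_apply, Nat.sub_add_cancel hnm]; exact hr.2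

theorem ps_of_weaklyDisjoint (T : FrechetOp)
    (h : ∀ (w : ℤ → ℝ) (B : L1Z →L[ℝ] L1Z), IsInvertibleWBSlp ℝ 1 w B → TopErgodic ⇑B →
      WeaklyDisjoint T.T ⇑B) : FTrans T.T {A : Set ℕ | IsPiecewiseSyndetic A} := by
  intro U V hU hV nU nV
  by_contra hps
  obtain ⟨w, B, hw, hE, U', V', hU', hV', nU', nV', hn⟩ :=
    exists_wshift _ (thickSyn_compl_of_not_ps hps)
  obtain ⟨n, h1, h2⟩ := nset_meet_of_weaklyDisjoint (h w B hw hE) hU hV hU' hV' nU nV nU' nV'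
  exact hn n h2 h1

/-- For an operator `T` the following are equivalent:
(1) `T` is `F_ps`-transitive; (2) `T` is weakly disjoint from every topologically
ergodic operator; (3) `T` is weakly disjoint from every invertible topologically
ergodic bilateral weighted backward shift on `c₀(ℤ)` or `ℓᵖ(ℤ)`, `1 ≤ p < ∞`. -/
theorem psTransitive_iff_weaklyDisjoint_from_topErgodic (T : FrechetOp) :
    (FTrans T.T {A : Set ℕ | IsPiecewiseSyndetic A} ↔
      ∀ S : FrechetOp, TopErgodic S.T → WeaklyDisjoint T.T S.T) ∧
    (FTrans T.T {A : Set ℕ | IsPiecewiseSyndetic A} ↔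
      ∀ (𝕜 : Type) [RCLike 𝕜],
        (∀ (p : ℝ≥0∞) [Fact (1 ≤ p)], p ≠ ∞ →
          ∀ (w : ℤ → ℝ) (B : lp (fun _ : ℤ => 𝕜) p →L[𝕜] lp (fun _ : ℤ => 𝕜) p),
            IsInvertibleWBSlp 𝕜 p w B → TopErgodic ⇑B → WeaklyDisjoint T.T ⇑B) ∧
        (∀ (w : ℤ → ℝ) (B : ZeroAtInftyContinuousMap ℤ 𝕜 →L[𝕜] ZeroAtInftyContinuousMap ℤ 𝕜),
            IsInvertibleWBSc0 𝕜 w B → TopErgodic ⇑B → WeaklyDisjoint T.T ⇑B)) := by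
  refine ⟨⟨fun h S hS => ?_, fun h => ?_⟩, ⟨fun h 𝕜 _ => ⟨?_, ?_⟩, fun h => ?_⟩⟩
  · let _ := S.instField
    exact weaklyDisjoint_of_ps T h S.linear.map_add S.cont hS
  · exact ps_of_weaklyDisjoint T fun w B _ hE => h (L1Zop B) hE
  · intro p _ hp w B _ hE
    have := lp_separable 𝕜 p hp
    exact weaklyDisjoint_of_ps T h (fun x y => map_add B x y) B.continuous hE
  · intro w B _ hE
    have := c0_separable 𝕜
    exact weaklyDisjoint_of_ps T h (fun x y => map_add B x y) B.continuous hE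
  · exact ps_of_weaklyDisjoint T fun w B hw hE => (h ℝ).1 1 (by simp) w B hw hE
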